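/- Assume c satisfies Assumptions (A) and (B), and let μ ∈ P(X), ν ∈ P(Y) with I_c(μ,ν) < +∞. Then every weak solution of the transport problem for (μ,ν) is a strong solution; in particular, there exists a nonnegative kernel q ∈ Q(μ,ν) with ∫ c(x,q^x) μ(dx) = I_c(μ,ν). -/

import Mathlib

open MeasureTheory ProbabilityTheory Topology Filter Set Metric
open scoped NNReal ENNReal

noncomputable section

namespace UWOT

/-- The nonnegative part of an extended real, as an extended nonnegative real. -/
def epos (x : EReal) : ℝ≥0∞ := if x = ⊤ then ⊤ else ENNReal.ofReal x.toReal

/-- Integral of an `EReal`-valued function: positive part minus negative part. -/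
def eintegral {α : Type*} [MeasurableSpace α] (μ : Measure α) (g : α → EReal) : EReal :=
  ((∫⁻ x, epos (g x) ∂μ : ℝ≥0∞) : EReal) - ((∫⁻ x, epos (-(g x)) ∂μ : ℝ≥0∞) : EReal)

/-- Integral of a real-valued function, with value `+∞` when the positive part is not
integrable.  This is the integral "understood in `ℝ ∪ {+∞}`". -/
def eintegralR {α : Type*} [MeasurableSpace α] (μ : Measure α) (f : α → ℝ) : EReal :=
  eintegral μ fun x => (f x : EReal)

variable {X Y : Type*}
  [TopologicalSpace X] [PolishSpace X] [MeasurableSpace X] [BorelSpace X]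
  [TopologicalSpace Y] [PolishSpace Y] [MeasurableSpace Y] [BorelSpace Y]

/-- A nonnegative kernel from `X` to `Y` : a measurable family of finite nonnegative
measures on `Y`. -/
def IsKernel (q : X → FiniteMeasure Y) : Prop :=
  Measurable fun x => (q x : Measure Y)

/-- `μ q = ν` : the kernel `q` transports `μ` onto `ν`. -/
def Transports (μ : Measure X) (q : X → FiniteMeasure Y) (ν : Measure Y) : Prop :=
  μ.bind (fun x => (q x : Measure Y)) = ν

/-- The transport cost `I_c(μ,ν)`, an infimum in `ℝ ∪ {+∞}` (it equals `⊤` when no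
admissible kernel exists). -/
def transportCost (c : X → FiniteMeasure Y → ℝ) (μ : Measure X) (ν : Measure Y) : EReal :=
  sInf {r : EReal | ∃ q : X → FiniteMeasure Y,
    IsKernel q ∧ Transports μ q ν ∧ r = eintegralR μ fun x => c x (q x)}

/-- Standing assumptions on the cost function: convexity in the second variable, joint
lower semicontinuity, and the lower bound (LB). -/
structure IsCost (c : X → FiniteMeasure Y → ℝ) : Prop where
  convex : ∀ (x : X) (m₀ m₁ : FiniteMeasure Y) (t : ℝ≥0), t ≤ 1 →
    c x ((1 - t) • m₀ + t • m₁) ≤ (1 - (t : ℝ)) * c x m₀ + (t : ℝ) * c x m₁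
  lsc : LowerSemicontinuous fun p : X × FiniteMeasure Y => c p.1 p.2
  lb : ∃ r₀ r₁ : ℝ, ∀ (x : X) (m : FiniteMeasure Y), r₀ + r₁ * (m.mass : ℝ) ≤ c x m

/-- The topological support of a measure. -/
def msupport {Z : Type*} [TopologicalSpace Z] [MeasurableSpace Z] (μ : Measure Z) : Set Z :=
  {x | ∀ U : Set Z, IsOpen U → x ∈ U → 0 < μ U}

/-- Membership in `Π(≪ μ, ν)`. -/
def MemPiAC (μ : Measure X) (ν : Measure Y) (π : ProbabilityMeasure (X × Y)) : Prop :=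
  (π : Measure (X × Y)).fst ≪ μ ∧ (π : Measure (X × Y)).snd = ν

/-- Membership in `Π(Supp(μ), ν)`. -/
def MemPiSupp (μ : Measure X) (ν : Measure Y) (π : ProbabilityMeasure (X × Y)) : Prop :=
  (π : Measure (X × Y)).fst (msupport μ) = 1 ∧ (π : Measure (X × Y)).snd = ν

variable [Nonempty Y]

/-- The disintegration kernel `π^x` of `π` with respect to its first marginal, as a
finite (probability) measure. -/
def condFM (π : ProbabilityMeasure (X × Y)) (x : X) : FiniteMeasure Y :=
  ⟨(π : Measure (X × Y)).condKernel x, inferInstance⟩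

/-- The measure `(dπ₁/dμ)(x) • π^x`. -/
def fiber (μ : Measure X) (π : ProbabilityMeasure (X × Y)) (x : X) : FiniteMeasure Y :=
  ((π : Measure (X × Y)).fst.rnDeriv μ x).toNNReal • condFM π x

/-- The functional `I_c^μ[π] = ∫ c(x, (dπ₁/dμ)(x) π^x) dμ`, in `ℝ ∪ {+∞}`. -/
def Icmu (c : X → FiniteMeasure Y → ℝ) (μ : Measure X) (π : ProbabilityMeasure (X × Y)) :
    EReal :=
  eintegralR μ fun x => c x (fiber μ π x)

/-- A strong solution of the transport problem. -/
def IsStrongSol (c : X → FiniteMeasure Y → ℝ) (μ : Measure X) (ν : Measure Y)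
    (π : ProbabilityMeasure (X × Y)) : Prop :=
  MemPiAC μ ν π ∧ Icmu c μ π = transportCost c μ ν

/-- A weak solution of the transport problem. -/
def IsWeakSol (c : X → FiniteMeasure Y → ℝ) (μ : Measure X) (ν : Measure Y)
    (π : ProbabilityMeasure (X × Y)) : Prop :=
  ∃ s : ℕ → ProbabilityMeasure (X × Y), (∀ n, MemPiAC μ ν (s n)) ∧
    Tendsto s atTop (𝓝 π) ∧
    Tendsto (fun n => Icmu c μ (s n)) atTop (𝓝 (transportCost c μ ν))

/-- The recession function `c'_∞(x,m) = lim_{λ→∞} c(x, λm)/λ`. -/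
def recession (c : X → FiniteMeasure Y → ℝ) (x : X) (m : FiniteMeasure Y) : EReal :=
  limsup (fun lam : ℝ≥0 => ((c x (lam • m) / (lam : ℝ) : ℝ) : EReal)) atTop

/-- The extended functional `bar I_c^μ[π]`. -/
def barI (c : X → FiniteMeasure Y → ℝ) (μ : Measure X) (π : ProbabilityMeasure (X × Y)) :
    EReal :=
  eintegralR μ (fun x => c x (fiber μ π x)) +
    eintegral ((π : Measure (X × Y)).fst.singularPart μ) (fun x => recession c x (condFM π x))

/-- Assumption (A). -/
def AssumpA (c : X → FiniteMeasure Y → ℝ) : Prop :=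
  ∃ (a : ℕ → C(X, ℝ)) (b : ℕ → C(X × Y, ℝ)),
    ∀ (x : X) (m : FiniteMeasure Y),
      IsLUB (range fun k => (∫ y, b k (x, y) ∂(m : Measure Y)) + a k x) (c x m)

/-- Assumption (B). -/
def AssumpB (c : X → FiniteMeasure Y → ℝ) : Prop :=
  ∀ (x : X) (m : FiniteMeasure Y), m ≠ 0 →
    Tendsto (fun lam : ℝ≥0 => c x (lam • m) / (lam : ℝ)) atTop atTop

/-- Assumption (C). -/
def AssumpC (c : X → FiniteMeasure Y → ℝ) : Prop :=
  (∀ m : FiniteMeasure Y, Continuous fun x : X => c x m) ∧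
  (∀ m : FiniteMeasure Y, Continuous fun x : X => recession c x m) ∧
  (∃ a : ℝ, 0 ≤ a ∧
    ∀ (x : X) (p : FiniteMeasure Y), p.mass = 1 → recession c x p ≤ (a : EReal))

/-- Assumption (Approx). -/
def AssumpApprox (c : X → FiniteMeasure Y → ℝ) : Prop :=
  ∀ (μ : Measure X) (ν : Measure Y), IsProbabilityMeasure μ → IsProbabilityMeasure ν →
    ∀ π : ProbabilityMeasure (X × Y), MemPiSupp μ ν π →
      ∃ s : ℕ → ProbabilityMeasure (X × Y), (∀ n, MemPiAC μ ν (s n)) ∧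
        Tendsto (fun n => Icmu c μ (s n)) atTop (𝓝 (barI c μ π))

/-- The operator `K_c` acting on continuous functions. -/
def Kc (c : X → FiniteMeasure Y → ℝ) (f : Y → ℝ) (x : X) : EReal :=
  ⨅ m : FiniteMeasure Y, (((∫ y, f y ∂(m : Measure Y)) + c x m : ℝ) : EReal)


section LatticeApproximation

variable {Z : Type*} [TopologicalSpace Z] [TopologicalSpace.PseudoMetrizableSpace Z]
  [MeasurableSpace Z] [BorelSpace Z]

/-- The maximum of two integrable functions is an `L¹` limit of continuous convex combinations. -/
theorem exists_continuous_convexComb_near_sup (ρ : Measure Z)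
    {g h : Z → ℝ} (hgm : Measurable g) (hhm : Measurable h)
    (hg : Integrable g ρ) (hh : Integrable h ρ) {ε : ℝ≥0∞} (hε : ε ≠ 0) :
    ∃ φ : C(Z, ℝ), (∀ x, φ x ∈ Icc (0 : ℝ) 1) ∧
      ∫⁻ x, ENNReal.ofReal |(φ x * g x + (1 - φ x) * h x) - g x ⊔ h x| ∂ρ ≤ ε := by
  have hDm : Measurable fun x => ENNReal.ofReal |g x - h x| :=
    (hgm.sub hhm).abs.ennreal_ofReal
  set τ := ρ.withDensity fun x => ENNReal.ofReal |g x - h x| with hτ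
  have : IsFiniteMeasure τ := isFiniteMeasure_withDensity_ofReal (hg.sub hh).abs.2
  have hA : MeasurableSet {x | h x ≤ g x} := measurableSet_le hhm hgm
  have hε2 : ε / 2 ≠ 0 := by simpa using hε
  obtain ⟨U, hAU, hU, -, hUlt⟩ :=
    hA.exists_isOpen_sdiff_lt (μ := τ) (measure_ne_top _ _) hε2
  obtain ⟨F, hFA, hF, hFlt⟩ :=
    hA.exists_isClosed_sdiff_lt (μ := τ) (measure_ne_top _ _) hε2
  have hdisj : Disjoint Uᶜ F :=
    disjoint_left.2 fun x hxU hxF => hxU (hAU (hFA hxF))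
  obtain ⟨φ, hφ0, hφ1, hφ⟩ := exists_continuous_zero_one_of_isClosed hU.isClosed_compl hF hdisj
  refine ⟨φ, hφ, ?_⟩
  have hUF : MeasurableSet (U \ F) := hU.measurableSet.diff hF.measurableSet
  have hsub : U \ F ⊆ (U \ {x | h x ≤ g x}) ∪ ({x | h x ≤ g x} \ F) := by
    rintro x ⟨hxU, hxF⟩
    by_cases hx : h x ≤ g x
    · exact Or.inr ⟨hx, hxF⟩
    · exact Or.inl ⟨hxU, hx⟩
  have hτle : τ (U \ F) ≤ ε := by
    calc τ (U \ F) ≤ _ := measure_mono hsub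
      _ ≤ _ := measure_union_le _ _
      _ ≤ ε / 2 + ε / 2 := add_le_add hUlt.le hFlt.le
      _ = ε := ENNReal.add_halves ε
  refine le_trans ?_ hτle
  rw [hτ, withDensity_apply _ hUF, ← lintegral_indicator hUF]
  refine lintegral_mono fun x => ?_
  obtain ⟨h0, h1⟩ := hφ x
  by_cases hxF : x ∈ F
  · have h1 : φ x = 1 := hφ1 hxF
    have h2 : h x ≤ g x := hFA hxF
    simp [h1, h2]
  · by_cases hxU : x ∈ U
    · rw [indicator_of_mem (show x ∈ U \ F from ⟨hxU, hxF⟩)]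
      refine ENNReal.ofReal_le_ofReal ?_
      rcases le_total (h x) (g x) with hx | hx
      · rw [sup_eq_left.2 hx, abs_of_nonneg (sub_nonneg.2 hx), abs_le]
        constructor <;> nlinarith
      · rw [sup_eq_right.2 hx, abs_of_nonpos (sub_nonpos.2 hx), abs_le]
        constructor <;> nlinarith
    · have h1 : φ x = 0 := hφ0 hxU
      have h2 : g x ≤ h x := (not_le.1 fun h' => hxU (hAU h')).le
      simp [h1, h2]

/-- A bound on the integrals of a class of functions stable under continuous convex combinations
passes to finite suprema of the class. -/
theorem integral_partialSups_le (ρ : Measure Z)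
    {G : Set (Z → ℝ)} (hGm : ∀ g ∈ G, Measurable g) (hGi : ∀ g ∈ G, Integrable g ρ)
    (hGc : ∀ g ∈ G, ∀ h ∈ G, ∀ φ : C(Z, ℝ), (∀ x, φ x ∈ Icc (0 : ℝ) 1) →
      (fun x => φ x * g x + (1 - φ x) * h x) ∈ G)
    {L : ℝ} (hGL : ∀ g ∈ G, ∫ x, g x ∂ρ ≤ L) {f : ℕ → Z → ℝ} (hf : ∀ n, f n ∈ G) (n : ℕ) :
    Measurable (partialSups f n) ∧ Integrable (partialSups f n) ρ ∧
      ∫ x, partialSups f n x ∂ρ ≤ L := by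
  have hS : ∀ n, Measurable (partialSups f n) ∧ Integrable (partialSups f n) ρ := by
    intro n
    induction n with
    | zero => simpa using ⟨hGm _ (hf 0), hGi _ (hf 0)⟩
    | succ n ih =>
      rw [partialSups_add_one]
      exact ⟨ih.1.sup (hGm _ (hf _)), ih.2.sup (hGi _ (hf _))⟩
  have key : ∀ n, ∀ ε : ℝ≥0∞, ε ≠ 0 → ∃ g ∈ G,
      ∫⁻ x, ENNReal.ofReal |g x - partialSups f n x| ∂ρ ≤ ε := by
    intro n
    induction n with
    | zero => exact fun ε _ => ⟨f 0, hf 0, by simp⟩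
    | succ n ih =>
      intro ε hε
      have hε2 : ε / 2 ≠ 0 := by simpa using hε
      obtain ⟨g, hg, hgle⟩ := ih (ε / 2) hε2
      obtain ⟨φ, hφ, hφle⟩ := exists_continuous_convexComb_near_sup ρ (hGm g hg)
        (hGm _ (hf (n + 1))) (hGi g hg) (hGi _ (hf (n + 1))) hε2
      refine ⟨_, hGc g hg _ (hf (n + 1)) φ hφ, ?_⟩
      rw [partialSups_add_one]
      calc _ ≤ ∫⁻ x, (ENNReal.ofReal
              |(φ x * g x + (1 - φ x) * f (n + 1) x) - g x ⊔ f (n + 1) x| +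
              ENNReal.ofReal |g x - partialSups f n x|) ∂ρ := by
            refine lintegral_mono fun x => ?_
            rw [← ENNReal.ofReal_add (abs_nonneg _) (abs_nonneg _)]
            refine ENNReal.ofReal_le_ofReal ((abs_sub_le _ (g x ⊔ f (n + 1) x) _).trans ?_)
            exact add_le_add le_rfl (abs_sup_sub_sup_le_abs _ _ _)
        _ = _ := lintegral_add_right _
            ((hGm g hg).sub (hS n).1).abs.ennreal_ofReal
        _ ≤ ε / 2 + ε / 2 := add_le_add hφle hgle
        _ = ε := ENNReal.add_halves ε
  refine ⟨(hS n).1, (hS n).2, le_of_forall_pos_le_add fun ε hε => ?_⟩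
  obtain ⟨g, hg, hgle⟩ := key n (ENNReal.ofReal ε) (by simpa using hε)
  have hi : Integrable (fun x => |g x - partialSups f n x|) ρ := ((hGi g hg).sub (hS n).2).abs
  have h1 : ∫ x, |g x - partialSups f n x| ∂ρ ≤ ε := by
    rw [← ENNReal.ofReal_le_ofReal_iff hε.le, ofReal_integral_eq_lintegral_ofReal hi
      (ae_of_all _ fun x => abs_nonneg _)]
    exact hgle
  have h2 : ∫ x, partialSups f n x ∂ρ ≤ ∫ x, (g x + |g x - partialSups f n x|) ∂ρ :=
    integral_mono (hS n).2 ((hGi g hg).add hi) fun x => by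
      have := neg_abs_le (g x - partialSups f n x)
      dsimp only
      linarith
  rw [integral_add (hGi g hg) hi] at h2
  linarith [hGL g hg]

/-- Monotone convergence for the supremum of a class stable under continuous convex
combinations. -/
theorem lintegral_iSup_sub_le (ρ : Measure Z)
    {G : Set (Z → ℝ)} (hGm : ∀ g ∈ G, Measurable g) (hGi : ∀ g ∈ G, Integrable g ρ)
    (hGc : ∀ g ∈ G, ∀ h ∈ G, ∀ φ : C(Z, ℝ), (∀ x, φ x ∈ Icc (0 : ℝ) 1) →
      (fun x => φ x * g x + (1 - φ x) * h x) ∈ G)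
    {L : ℝ} (hGL : ∀ g ∈ G, ∫ x, g x ∂ρ ≤ L) {f : ℕ → Z → ℝ} (hf : ∀ n, f n ∈ G) :
    Measurable (fun x => ⨆ n, ENNReal.ofReal (f n x - f 0 x)) ∧
      ∫⁻ x, ⨆ n, ENNReal.ofReal (f n x - f 0 x) ∂ρ ≤ ENNReal.ofReal (L - ∫ x, f 0 x ∂ρ) := by
  have hm : ∀ n, Measurable fun x => ENNReal.ofReal (f n x - f 0 x) := fun n =>
    ((hGm _ (hf n)).sub (hGm _ (hf 0))).ennreal_ofReal
  refine ⟨Measurable.iSup hm, ?_⟩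
  have hP := integral_partialSups_le ρ hGm hGi hGc hGL hf
  calc _ ≤ ∫⁻ x, ⨆ n, ENNReal.ofReal (partialSups f n x - f 0 x) ∂ρ := by
        refine lintegral_mono fun x => iSup_mono fun n => ENNReal.ofReal_le_ofReal ?_
        exact sub_le_sub_right (le_partialSups f n x) _
    _ = ⨆ n, ∫⁻ x, ENNReal.ofReal (partialSups f n x - f 0 x) ∂ρ := by
        refine lintegral_iSup (fun n => ((hP n).1.sub (hGm _ (hf 0))).ennreal_ofReal) ?_
        intro m n hmn x
        exact ENNReal.ofReal_le_ofReal (sub_le_sub_right ((partialSups f).mono hmn x) _)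
    _ ≤ _ := by
        refine iSup_le fun n => ?_
        have hi : Integrable (fun x => partialSups f n x - f 0 x) ρ :=
          (hP n).2.1.sub (hGi _ (hf 0))
        rw [← ofReal_integral_eq_lintegral_ofReal hi]
        · refine ENNReal.ofReal_le_ofReal ?_
          rw [integral_sub (hP n).2.1 (hGi _ (hf 0))]
          exact sub_le_sub_right (hP n).2.2 _
        · exact ae_of_all _ fun x =>
            sub_nonneg.2 (le_partialSups_of_le f (Nat.zero_le n) x)

end LatticeApproximation

section ExtendedIntegral

variable {α : Type*} [MeasurableSpace α] {ρ : Measure α}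

@[simp]
theorem epos_coe (r : ℝ) : epos (r : EReal) = ENNReal.ofReal r := by simp [epos]

theorem eintegralR_eq (f : α → ℝ) :
    eintegralR ρ f = ((∫⁻ x, ENNReal.ofReal (f x) ∂ρ : ℝ≥0∞) : EReal) -
      ((∫⁻ x, ENNReal.ofReal (-f x) ∂ρ : ℝ≥0∞) : EReal) := by
  simp only [eintegralR, eintegral, ← EReal.coe_neg, epos_coe]

theorem eintegralR_congr_ae {f g : α → ℝ} (h : f =ᵐ[ρ] g) : eintegralR ρ f = eintegralR ρ g := by
  simp only [eintegralR_eq]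
  have h1 : ∫⁻ x, ENNReal.ofReal (f x) ∂ρ = ∫⁻ x, ENNReal.ofReal (g x) ∂ρ :=
    lintegral_congr_ae (h.mono fun x hx => by simp only [hx])
  have h2 : ∫⁻ x, ENNReal.ofReal (-f x) ∂ρ = ∫⁻ x, ENNReal.ofReal (-g x) ∂ρ :=
    lintegral_congr_ae (h.mono fun x hx => by simp only [hx])
  rw [h1, h2]

theorem eintegralR_mono {f g : α → ℝ} (h : f ≤ᵐ[ρ] g) : eintegralR ρ f ≤ eintegralR ρ g := by
  simp only [eintegralR_eq]
  refine EReal.sub_le_sub ?_ ?_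
  · exact_mod_cast lintegral_mono_ae (h.mono fun x hx => ENNReal.ofReal_le_ofReal hx)
  · exact_mod_cast lintegral_mono_ae (h.mono fun x hx => ENNReal.ofReal_le_ofReal (neg_le_neg hx))

theorem eintegralR_eq_integral {f : α → ℝ} (hf : Integrable f ρ) :
    eintegralR ρ f = ((∫ x, f x ∂ρ : ℝ) : EReal) := by
  have h1 : ∫⁻ x, ENNReal.ofReal (f x) ∂ρ ≠ ⊤ := hf.lintegral_lt_top.ne
  have h2 : ∫⁻ x, ENNReal.ofReal (-f x) ∂ρ ≠ ⊤ := hf.neg.lintegral_lt_top.ne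
  rw [eintegralR_eq, integral_eq_lintegral_pos_part_sub_lintegral_neg_part hf, EReal.coe_sub,
    EReal.coe_ennreal_toReal h1, EReal.coe_ennreal_toReal h2]

end ExtendedIntegral

section Fiber

omit [TopologicalSpace X] [PolishSpace X] [BorelSpace X] in
theorem integral_fiber (ρ : Measure X) (π : ProbabilityMeasure (X × Y)) (x : X) (f : Y → ℝ) :
    ∫ y, f y ∂(fiber ρ π x : Measure Y) =
      ((π : Measure (X × Y)).fst.rnDeriv ρ x).toReal *
        ∫ y, f y ∂(π : Measure (X × Y)).condKernel x := by
  rw [fiber, FiniteMeasure.toMeasure_smul, integral_smul_nnreal_measure]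
  rfl

theorem integrable_of_continuous_compact {Z : Type*} [TopologicalSpace Z] [CompactSpace Z]
    [MeasurableSpace Z] [OpensMeasurableSpace Z] (ρ : Measure Z) [IsFiniteMeasure ρ]
    {f : Z → ℝ} (hf : Continuous f) : Integrable f ρ :=
  (BoundedContinuousFunction.mkOfCompact ⟨f, hf⟩).integrable ρ

omit [PolishSpace X] in
theorem measurable_integral_fiber (ρ : Measure X) (π : ProbabilityMeasure (X × Y))
    (β : C(X × Y, ℝ)) : Measurable fun x => ∫ y, β (x, y) ∂(fiber ρ π x : Measure Y) := by
  simp only [integral_fiber]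
  refine (Measure.measurable_rnDeriv _ _).ennreal_toReal.mul (StronglyMeasurable.measurable ?_)
  exact StronglyMeasurable.integral_kernel_prod_right (f := fun x y => β (x, y))
    β.continuous.measurable.stronglyMeasurable

section Compact

variable [CompactSpace X] [CompactSpace Y]

theorem integrable_integral_fiber {ρ : Measure X} {π : ProbabilityMeasure (X × Y)}
    (h : (π : Measure (X × Y)).fst ≪ ρ) [SigmaFinite ρ] (β : C(X × Y, ℝ)) :
    Integrable (fun x => ∫ y, β (x, y) ∂(fiber ρ π x : Measure Y)) ρ := by
  simp only [integral_fiber]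
  exact (integrable_rnDeriv_smul_iff h).2
    (integrable_of_continuous_compact (π : Measure (X × Y)) β.continuous).integral_condKernel

theorem integral_integral_fiber {ρ : Measure X} {π : ProbabilityMeasure (X × Y)}
    (h : (π : Measure (X × Y)).fst ≪ ρ) [SigmaFinite ρ] (β : C(X × Y, ℝ)) :
    ∫ x, ∫ y, β (x, y) ∂(fiber ρ π x : Measure Y) ∂ρ = ∫ p, β p ∂(π : Measure (X × Y)) := by
  simp only [integral_fiber]
  rw [← Measure.integral_condKernel
    (integrable_of_continuous_compact (π : Measure (X × Y)) β.continuous)]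
  exact integral_rnDeriv_smul h

end Compact

omit [TopologicalSpace X] [PolishSpace X] [BorelSpace X] in
theorem isKernel_fiber (μ : Measure X) (π : ProbabilityMeasure (X × Y)) :
    IsKernel (fiber μ π) := by
  refine Measure.measurable_of_measurable_coe _ fun A hA => ?_
  have : (fun x => (fiber μ π x : Measure Y) A) = fun x =>
      (((π : Measure (X × Y)).fst.rnDeriv μ x).toNNReal : ℝ≥0∞) *
        (π : Measure (X × Y)).condKernel x A := by
    funext x
    rw [fiber, FiniteMeasure.toMeasure_smul, Measure.smul_apply]
    rfl
  rw [this]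
  exact (Measure.measurable_rnDeriv _ _).ennreal_toNNReal.coe_nnreal_ennreal.mul
    (Kernel.measurable_coe _ hA)

omit [BorelSpace X] in
theorem transports_fiber {μ : Measure X} [SigmaFinite μ] {π : ProbabilityMeasure (X × Y)}
    (h : (π : Measure (X × Y)).fst ≪ μ) :
    Transports μ (fiber μ π) (π : Measure (X × Y)).snd := by
  refine Measure.ext fun A hA => ?_
  rw [Measure.bind_apply hA (isKernel_fiber μ π).aemeasurable]
  calc ∫⁻ x, (fiber μ π x : Measure Y) A ∂μ
      = ∫⁻ x, (π : Measure (X × Y)).fst.rnDeriv μ x *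
          (π : Measure (X × Y)).condKernel x A ∂μ := by
        refine lintegral_congr_ae ?_
        filter_upwards [Measure.rnDeriv_ne_top (π : Measure (X × Y)).fst μ] with x hx
        rw [fiber, FiniteMeasure.toMeasure_smul, Measure.smul_apply]
        change (((π : Measure (X × Y)).fst.rnDeriv μ x).toNNReal : ℝ≥0∞) * _ = _
        rw [ENNReal.coe_toNNReal hx]
        rfl
    _ = ∫⁻ x, (π : Measure (X × Y)).condKernel x A ∂(π : Measure (X × Y)).fst :=
        lintegral_rnDeriv_mul h (Kernel.measurable_coe _ hA).aemeasurable
    _ = (π : Measure (X × Y)).snd A := by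
        rw [Measure.snd_apply hA]
        conv_rhs => rw [← (π : Measure (X × Y)).disintegrate
          (π : Measure (X × Y)).condKernel]
        rw [Measure.compProd_apply (measurable_snd hA)]
        rfl

omit [BorelSpace X] in
theorem transportCost_le_Icmu (c : X → FiniteMeasure Y → ℝ) {μ : Measure X} [SigmaFinite μ]
    {ν : Measure Y} {π : ProbabilityMeasure (X × Y)} (h : MemPiAC μ ν π) :
    transportCost c μ ν ≤ Icmu c μ π :=
  sInf_le ⟨fiber μ π, isKernel_fiber μ π, h.2 ▸ transports_fiber h.1, rfl⟩

/-- Every kernel transporting `μ` onto a probability measure comes from an admissible plan. -/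
theorem exists_memPiAC_Icmu_eq (c : X → FiniteMeasure Y → ℝ) (μ : Measure X)
    [IsProbabilityMeasure μ] (ν : Measure Y) [IsProbabilityMeasure ν] {q : X → FiniteMeasure Y}
    (hq : IsKernel q) (hqν : Transports μ q ν) :
    ∃ π : ProbabilityMeasure (X × Y), MemPiAC μ ν π ∧
      Icmu c μ π = eintegralR μ fun x => c x (q x) := by
  have hqm : ∀ A, MeasurableSet A → Measurable fun x => (q x : Measure Y) A :=
    fun A hA => (Measure.measurable_coe hA).comp hq
  have hν : ∀ A, MeasurableSet A → ν A = ∫⁻ x, (q x : Measure Y) A ∂μ := fun A hA => by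
    rw [← hqν, Measure.bind_apply hA hq.aemeasurable]
  let m : X → ℝ≥0∞ := fun x => (q x : Measure Y) univ
  have hm : Measurable m := hqm univ .univ
  obtain ⟨y₀⟩ := ‹Nonempty Y›
  have hS : MeasurableSet {x | m x = 0} := hm (measurableSet_singleton 0)
  classical
  let k : X → Measure Y := fun x => if m x = 0 then Measure.dirac y₀ else (m x)⁻¹ • (q x : Measure Y)
  have hk : Measurable k := by
    refine Measure.measurable_of_measurable_coe _ fun A hA => ?_
    have : (fun x => k x A) = fun x => if m x = 0 then Measure.dirac y₀ A else
        (m x)⁻¹ * (q x : Measure Y) A := by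
      funext x
      by_cases hx : m x = 0 <;> simp [k, hx]
    rw [this]
    exact Measurable.ite hS measurable_const (hm.inv.mul (hqm A hA))
  let κ : Kernel X Y := ⟨k, hk⟩
  have hκ : IsMarkovKernel κ := ⟨fun x => ⟨by
    change k x univ = 1
    by_cases hx : m x = 0
    · simp [k, hx]
    · simp only [k, hx, if_false, Measure.smul_apply, smul_eq_mul]
      exact ENNReal.inv_mul_cancel hx (measure_ne_top _ _)⟩⟩
  have hmk : ∀ x A, m x * κ x A = (q x : Measure Y) A := fun x A => by
    change m x * k x A = _
    by_cases hx : m x = 0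
    · rw [hx, zero_mul]
      exact (measure_mono_null (subset_univ A) hx).symm
    · simp only [k, hx, if_false, Measure.smul_apply, smul_eq_mul]
      rw [← mul_assoc, ENNReal.mul_inv_cancel hx (measure_ne_top _ _), one_mul]
  have hprob : IsProbabilityMeasure (μ.withDensity m) :=
    ⟨by rw [withDensity_apply _ .univ, setLIntegral_univ, ← hν univ .univ, measure_univ]⟩
  let π : ProbabilityMeasure (X × Y) := ⟨μ.withDensity m ⊗ₘ κ, inferInstance⟩
  have hfst : (π : Measure (X × Y)).fst = μ.withDensity m := Measure.fst_compProd _ _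
  refine ⟨π, ⟨?_, ?_⟩, ?_⟩
  · rw [hfst]
    exact withDensity_absolutelyContinuous _ _
  · refine Measure.ext fun A hA => ?_
    rw [Measure.snd_apply hA]
    change (μ.withDensity m ⊗ₘ κ) _ = _
    rw [Measure.compProd_apply (measurable_snd hA), hν A hA,
      lintegral_withDensity_eq_lintegral_mul _ hm (Kernel.measurable_kernel_prodMk_left
        (measurable_snd hA))]
    exact lintegral_congr fun x => hmk x A
  · refine eintegralR_congr_ae ?_
    have h1 := eq_condKernel_of_measure_eq_compProd (ρ := (π : Measure (X × Y))) κ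
      (by rw [hfst]; rfl)
    rw [hfst, ae_withDensity_iff hm] at h1
    have h2 : (π : Measure (X × Y)).fst.rnDeriv μ =ᵐ[μ] m := by
      rw [hfst]
      exact Measure.rnDeriv_withDensity μ hm
    filter_upwards [h1, h2] with x hx1 hx2
    suffices fiber μ π x = q x by rw [this]
    refine FiniteMeasure.toMeasure_injective (Measure.ext fun A _ => ?_)
    rw [fiber, FiniteMeasure.toMeasure_smul, Measure.smul_apply, hx2]
    change ((m x).toNNReal : ℝ≥0∞) * (π : Measure (X × Y)).condKernel x A = _
    rw [ENNReal.coe_toNNReal (measure_ne_top _ _), ← hmk x A]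
    by_cases hx : m x = 0
    · change m x * _ = m x * _
      rw [hx, zero_mul, zero_mul]
    · rw [hx1 hx]

end Fiber

section Minorant

/-- A continuous affine minorant of the cost. -/
def IsMinorant (c : X → FiniteMeasure Y → ℝ) (β : C(X × Y, ℝ)) (α : C(X, ℝ)) : Prop :=
  ∀ (x : X) (m : FiniteMeasure Y), ∫ y, β (x, y) ∂(m : Measure Y) + α x ≤ c x m

variable [CompactSpace X] [CompactSpace Y] {c : X → FiniteMeasure Y → ℝ}

theorem IsMinorant.integral_le_Icmu {β : C(X × Y, ℝ)} {α : C(X, ℝ)} (h : IsMinorant c β α)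
    {μ : Measure X} [IsFiniteMeasure μ] {π : ProbabilityMeasure (X × Y)}
    (hπ : (π : Measure (X × Y)).fst ≪ μ) :
    ((∫ p, β p ∂(π : Measure (X × Y)) + ∫ x, α x ∂μ : ℝ) : EReal) ≤ Icmu c μ π := by
  have h1 := integrable_integral_fiber hπ β
  have h2 := integrable_of_continuous_compact μ α.continuous
  rw [← integral_integral_fiber hπ β, ← integral_add' h1 h2, ← eintegralR_eq_integral (h1.add h2)]
  exact eintegralR_mono (ae_of_all _ fun x => h x _)

theorem IsMinorant.integral_le_of_tendsto {β : C(X × Y, ℝ)} {α : C(X, ℝ)}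
    (h : IsMinorant c β α) {μ : Measure X} [IsFiniteMeasure μ] {ι : Type*} {l : Filter ι} [l.NeBot]
    {s : ι → ProbabilityMeasure (X × Y)} {π : ProbabilityMeasure (X × Y)}
    (hs : ∀ i, (s i : Measure (X × Y)).fst ≪ μ) (hsπ : Tendsto s l (𝓝 π)) {T : EReal}
    (hT : Tendsto (fun i => Icmu c μ (s i)) l (𝓝 T)) :
    ((∫ p, β p ∂(π : Measure (X × Y)) + ∫ x, α x ∂μ : ℝ) : EReal) ≤ T := by
  have h1 := (ProbabilityMeasure.tendsto_iff_forall_integral_tendsto.1 hsπ)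
    (BoundedContinuousFunction.mkOfCompact β)
  have h2 := (continuous_coe_real_ereal.tendsto _).comp (h1.add_const (∫ x, α x ∂μ))
  exact le_of_tendsto_of_tendsto' h2 hT fun i => h.integral_le_Icmu (hs i)

omit [CompactSpace X] [PolishSpace X] [MeasurableSpace X] [BorelSpace X] [PolishSpace Y]
  [Nonempty Y] in
theorem IsMinorant.convexComb {β β' : C(X × Y, ℝ)} {α α' : C(X, ℝ)} (h : IsMinorant c β α)
    (h' : IsMinorant c β' α') {φ : C(X, ℝ)} (hφ : ∀ x, φ x ∈ Icc (0 : ℝ) 1) :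
    IsMinorant c
      ⟨fun p => φ p.1 * β p + (1 - φ p.1) * β' p, by fun_prop⟩
      ⟨fun x => φ x * α x + (1 - φ x) * α' x, by fun_prop⟩ := by
  intro x m
  have hi : ∀ γ : C(X × Y, ℝ), Integrable (fun y => γ (x, y)) (m : Measure Y) := fun γ =>
    integrable_of_continuous_compact _ (by fun_prop)
  simp only [ContinuousMap.coe_mk]
  rw [integral_add ((hi β).const_mul _) ((hi β').const_mul _), integral_const_mul,
    integral_const_mul]
  have h0 := mul_le_mul_of_nonneg_left (h x m) (hφ x).1
  have h1 := mul_le_mul_of_nonneg_left (h' x m) (sub_nonneg.2 (hφ x).2)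
  linarith

/-- Monotone convergence along a sequence of minorants, over a reference measure dominating both
`μ` and the first marginal of the plan. -/
theorem lintegral_iSup_minorant_le {μ ρ : Measure X} [IsFiniteMeasure μ] [IsFiniteMeasure ρ]
    {π : ProbabilityMeasure (X × Y)} (hμ : μ ≪ ρ) (hπ : (π : Measure (X × Y)).fst ≪ ρ) {L : ℝ}
    (hL : ∀ β α, IsMinorant c β α →
      ∫ p, β p ∂(π : Measure (X × Y)) + ∫ x, α x ∂μ ≤ L)
    {b : ℕ → C(X × Y, ℝ)} {a : ℕ → C(X, ℝ)} (hab : ∀ k, IsMinorant c (b k) (a k))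
    {f : ℕ → X → ℝ} (hf : ∀ k x, f k x =
      ∫ y, b k (x, y) ∂(fiber ρ π x : Measure Y) + (μ.rnDeriv ρ x).toReal * a k x) :
    (∀ k, Measurable (f k) ∧ Integrable (f k) ρ ∧ ∫ x, f k x ∂ρ ≤ L) ∧
    Measurable (fun x => ⨆ n, ENNReal.ofReal (f n x - f 0 x)) ∧
      ∫⁻ x, ⨆ n, ENNReal.ofReal (f n x - f 0 x) ∂ρ ≤ ENNReal.ofReal (L - ∫ x, f 0 x ∂ρ) := by
  let F : C(X × Y, ℝ) → C(X, ℝ) → X → ℝ := fun β α x =>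
    ∫ y, β (x, y) ∂(fiber ρ π x : Measure Y) + (μ.rnDeriv ρ x).toReal * α x
  let G : Set (X → ℝ) := {g | ∃ β α, IsMinorant c β α ∧ g = F β α}
  have hα : ∀ α : C(X, ℝ), Integrable (fun x => (μ.rnDeriv ρ x).toReal * α x) ρ := fun α =>
    (integrable_rnDeriv_smul_iff hμ).2 (integrable_of_continuous_compact μ α.continuous)
  have hGm : ∀ g ∈ G, Measurable g := by
    rintro _ ⟨β, α, -, rfl⟩
    exact (measurable_integral_fiber ρ π β).add
      ((Measure.measurable_rnDeriv _ _).ennreal_toReal.mul α.continuous.measurable)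
  have hGi : ∀ g ∈ G, Integrable g ρ := by
    rintro _ ⟨β, α, -, rfl⟩
    exact (integrable_integral_fiber hπ β).add (hα α)
  have hGL : ∀ g ∈ G, ∫ x, g x ∂ρ ≤ L := by
    rintro _ ⟨β, α, h, rfl⟩
    refine le_of_eq_of_le ?_ (hL β α h)
    rw [← integral_integral_fiber hπ β, ← integral_rnDeriv_smul hμ]
    exact integral_add (integrable_integral_fiber hπ β) (hα α)
  have hGc : ∀ g ∈ G, ∀ h ∈ G, ∀ φ : C(X, ℝ), (∀ x, φ x ∈ Icc (0 : ℝ) 1) →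
      (fun x => φ x * g x + (1 - φ x) * h x) ∈ G := by
    rintro _ ⟨β, α, h, rfl⟩ _ ⟨β', α', h', rfl⟩ φ hφ
    refine ⟨_, _, h.convexComb h' hφ, funext fun x => ?_⟩
    have hi : ∀ γ : C(X × Y, ℝ), Integrable (fun y => γ (x, y)) (fiber ρ π x : Measure Y) :=
      fun γ => integrable_of_continuous_compact _ (by fun_prop)
    simp only [F, ContinuousMap.coe_mk]
    rw [integral_add ((hi β).const_mul _) ((hi β').const_mul _), integral_const_mul,
      integral_const_mul]
    ring
  have hfG : ∀ k, f k ∈ G := fun k => ⟨b k, a k, hab k, funext fun x => hf k x⟩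
  exact ⟨fun k => ⟨hGm _ (hfG k), hGi _ (hfG k), hGL _ (hfG k)⟩,
    lintegral_iSup_sub_le ρ hGm hGi hGc hGL hfG⟩

end Minorant

section StrongSolution

variable {c : X → FiniteMeasure Y → ℝ}

omit [TopologicalSpace X] [PolishSpace X] [MeasurableSpace X] [BorelSpace X] [PolishSpace Y]
  [BorelSpace Y] [TopologicalSpace Y] [Nonempty Y] in
/-- Superlinear growth of the cost makes the slopes of its affine minorants unbounded. -/
theorem not_bddAbove_slopes (hB : AssumpB c) {a : ℕ → X → ℝ} {b : ℕ → X × Y → ℝ} {x : X}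
    (hab : ∀ m : FiniteMeasure Y,
      IsLUB (range fun k => (∫ y, b k (x, y) ∂(m : Measure Y)) + a k x) (c x m))
    {p : FiniteMeasure Y} (hp : p ≠ 0) {M : ℝ} :
    ¬ ∀ k, ∫ y, b k (x, y) ∂(p : Measure Y) ≤ M := by
  intro hM
  have ha : ∀ k, a k x ≤ c x 0 := fun k => by
    have := (hab 0).1 (mem_range_self k)
    simpa using this
  obtain ⟨lam, hlam1, hlam⟩ := ((eventually_ge_atTop (1 : ℝ≥0)).and
    ((hB x p hp).eventually_gt_atTop (M + |c x 0|))).exists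
  have h1 : (1 : ℝ) ≤ lam := by exact_mod_cast hlam1
  rw [lt_div_iff₀ (by linarith)] at hlam
  refine absurd ((hab (lam • p)).2 ?_) (not_le.2 hlam)
  rintro _ ⟨k, rfl⟩
  simp only [FiniteMeasure.toMeasure_smul, integral_smul_nnreal_measure]
  have h2 : (lam : ℝ) * ∫ y, b k (x, y) ∂(p : Measure Y) ≤ lam * M :=
    mul_le_mul_of_nonneg_left (hM k) lam.2
  have h3 : |c x 0| ≤ lam * |c x 0| := le_mul_of_one_le_left (abs_nonneg _) h1
  have h4 := le_abs_self (c x 0)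
  have h5 := ha k
  rw [NNReal.smul_def, smul_eq_mul]
  nlinarith

variable [CompactSpace X] [CompactSpace Y]

/-- A plan satisfying the dual inequality against all continuous affine minorants has a first
marginal absolutely continuous with respect to `μ`. -/
theorem fst_absolutelyContinuous_of_minorant_le (hA : AssumpA c) (hB : AssumpB c)
    {μ : Measure X} [IsFiniteMeasure μ] {π : ProbabilityMeasure (X × Y)} {L : ℝ}
    (hL : ∀ β α, IsMinorant c β α →
      ∫ p, β p ∂(π : Measure (X × Y)) + ∫ x, α x ∂μ ≤ L) :
    (π : Measure (X × Y)).fst ≪ μ := by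
  obtain ⟨a, b, hab⟩ := hA
  have hmin : ∀ k, IsMinorant c (b k) (a k) := fun k x m => (hab x m).1 (mem_range_self k)
  set ρ := μ + (π : Measure (X × Y)).fst with hρ
  have hμρ : μ ≪ ρ := Measure.absolutelyContinuous_of_le (Measure.le_add_right le_rfl)
  have hπρ : (π : Measure (X × Y)).fst ≪ ρ :=
    Measure.absolutelyContinuous_of_le (Measure.le_add_left le_rfl)
  set f : ℕ → X → ℝ := fun k x =>
    ∫ y, b k (x, y) ∂(fiber ρ π x : Measure Y) + (μ.rnDeriv ρ x).toReal * a k x with hf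
  obtain ⟨-, hm, hle⟩ := lintegral_iSup_minorant_le hμρ hπρ hL hmin (f := f) fun k x => rfl
  have hfin := ae_lt_top hm (hle.trans_lt ENNReal.ofReal_lt_top).ne
  have himp : ∀ᵐ x ∂ρ, μ.rnDeriv ρ x = 0 → (π : Measure (X × Y)).fst.rnDeriv ρ x = 0 := by
    filter_upwards [hfin, Measure.rnDeriv_ne_top (π : Measure (X × Y)).fst ρ] with x hx hxt hx0
    by_contra hne
    have hw : 0 < ((π : Measure (X × Y)).fst.rnDeriv ρ x).toReal := ENNReal.toReal_pos hne hxt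
    have hp : condFM π x ≠ 0 := by
      intro h
      have h1 : (condFM π x : Measure Y) univ = 1 :=
        measure_univ (μ := (π : Measure (X × Y)).condKernel x)
      rw [h] at h1
      simp at h1
    set S := ⨆ n, ENNReal.ofReal (f n x - f 0 x) with hS
    refine not_bddAbove_slopes (M := (S.toReal + f 0 x) /
      ((π : Measure (X × Y)).fst.rnDeriv ρ x).toReal) hB (hab x) hp fun k => ?_
    have h1 : f k x - f 0 x ≤ S.toReal := (ENNReal.ofReal_le_iff_le_toReal hx.ne).1
      (le_iSup (fun n => ENNReal.ofReal (f n x - f 0 x)) k)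
    have h2 : f k x = ((π : Measure (X × Y)).fst.rnDeriv ρ x).toReal *
        ∫ y, b k (x, y) ∂(π : Measure (X × Y)).condKernel x := by
      simp only [hf, hx0, integral_fiber, ENNReal.toReal_zero, zero_mul, add_zero]
    rw [le_div_iff₀ hw, mul_comm]
    exact h2.symm.le.trans (by linarith)
  refine Measure.AbsolutelyContinuous.mk fun A hA hμA => ?_
  rw [← Measure.setLIntegral_rnDeriv hπρ, setLIntegral_eq_zero_iff hA
    (Measure.measurable_rnDeriv _ _)]
  rw [← Measure.setLIntegral_rnDeriv hμρ, setLIntegral_eq_zero_iff hA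
    (Measure.measurable_rnDeriv _ _)] at hμA
  filter_upwards [himp, hμA] with x h1 h2 hxA using h1 (h2 hxA)

/-- Under Assumption (A), the cost of an admissible plan is the supremum of its dual
lower bounds. -/
theorem Icmu_le_of_minorant_le (hA : AssumpA c) {μ : Measure X} [IsFiniteMeasure μ]
    {π : ProbabilityMeasure (X × Y)} (hπ : (π : Measure (X × Y)).fst ≪ μ) {L : ℝ}
    (hL : ∀ β α, IsMinorant c β α →
      ∫ p, β p ∂(π : Measure (X × Y)) + ∫ x, α x ∂μ ≤ L) :
    Icmu c μ π ≤ L := by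
  obtain ⟨a, b, hab⟩ := hA
  have hmin : ∀ k, IsMinorant c (b k) (a k) := fun k x m => (hab x m).1 (mem_range_self k)
  set f : ℕ → X → ℝ := fun k x =>
    ∫ y, b k (x, y) ∂(fiber μ π x : Measure Y) + (μ.rnDeriv μ x).toReal * a k x
  obtain ⟨hk, hm, hle⟩ := lintegral_iSup_minorant_le Measure.AbsolutelyContinuous.rfl hπ hL hmin
    (f := f) fun k x => rfl
  have hfin := ae_lt_top hm (hle.trans_lt ENNReal.ofReal_lt_top).ne
  have hcm : Measurable fun x => c x (fiber μ π x) :=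
    Measurable.isLUB (fun k => (measurable_integral_fiber μ π (b k)).add
      (a k).continuous.measurable) fun x => hab x (fiber μ π x)
  have hbd : ∀ᵐ x ∂μ, f 0 x ≤ c x (fiber μ π x) ∧
      ENNReal.ofReal (c x (fiber μ π x) - f 0 x) ≤ ⨆ n, ENNReal.ofReal (f n x - f 0 x) := by
    filter_upwards [hfin, Measure.rnDeriv_self μ] with x hx h1
    have hfx : ∀ k, f k x = ∫ y, b k (x, y) ∂(fiber μ π x : Measure Y) + a k x := fun k => by
      simp [f, h1]
    refine ⟨hfx 0 ▸ hmin 0 x _, ?_⟩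
    rw [ENNReal.ofReal_le_iff_le_toReal hx.ne, sub_le_iff_le_add]
    refine (hab x (fiber μ π x)).2 ?_
    rintro _ ⟨k, rfl⟩
    have h2 := (ENNReal.ofReal_le_iff_le_toReal hx.ne).1
      (le_iSup (fun n => ENNReal.ofReal (f n x - f 0 x)) k)
    rw [← sub_le_iff_le_add]
    simpa only [hfx k] using h2
  have hle' : ∫⁻ x, ENNReal.ofReal (c x (fiber μ π x) - f 0 x) ∂μ ≤
      ENNReal.ofReal (L - ∫ x, f 0 x ∂μ) := (lintegral_mono_ae (hbd.mono fun x h => h.2)).trans hle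
  have hnn : 0 ≤ᵐ[μ] fun x => c x (fiber μ π x) - f 0 x := hbd.mono fun x h => sub_nonneg.2 h.1
  have hdi : Integrable (fun x => c x (fiber μ π x) - f 0 x) μ :=
    (lintegral_ofReal_ne_top_iff_integrable (hcm.sub (hk 0).1).aestronglyMeasurable hnn).1
      (hle'.trans_lt ENNReal.ofReal_lt_top).ne
  have hci : Integrable (fun x => c x (fiber μ π x)) μ := by
    refine (hdi.add (hk 0).2.1).congr (ae_of_all _ fun x => ?_)
    simp only [Pi.add_apply, sub_add_cancel]
  rw [← ofReal_integral_eq_lintegral_ofReal hdi hnn,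
    ENNReal.ofReal_le_ofReal_iff (sub_nonneg.2 (hk 0).2.2), integral_sub hci (hk 0).2.1] at hle'
  rw [Icmu, eintegralR_eq_integral hci]
  exact_mod_cast (sub_le_sub_iff_right _).1 hle'

/-- Limits of minimizing families of plans are strong solutions. -/
theorem isStrongSol_of_tendsto (hA : AssumpA c) (hB : AssumpB c) {μ : Measure X}
    [IsFiniteMeasure μ] {ν : Measure Y} (hfin : transportCost c μ ν ≠ ⊤)
    {ι : Type*} {l : Filter ι} [l.NeBot] {s : ι → ProbabilityMeasure (X × Y)}
    {π : ProbabilityMeasure (X × Y)} (hs : ∀ i, MemPiAC μ ν (s i)) (hsπ : Tendsto s l (𝓝 π))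
    (hT : Tendsto (fun i => Icmu c μ (s i)) l (𝓝 (transportCost c μ ν))) :
    IsStrongSol c μ ν π := by
  have hlim : ∀ β α, IsMinorant c β α →
      ((∫ p, β p ∂(π : Measure (X × Y)) + ∫ x, α x ∂μ : ℝ) : EReal) ≤ transportCost c μ ν :=
    fun β α h => h.integral_le_of_tendsto (fun i => (hs i).1) hsπ hT
  have hbot : transportCost c μ ν ≠ ⊥ := by
    obtain ⟨a, b, hab⟩ := hA
    exact ne_bot_of_le_ne_bot (EReal.coe_ne_bot _)
      (hlim (b 0) (a 0) fun x m => (hab x m).1 (mem_range_self 0))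
  have hL : ∀ β α, IsMinorant c β α →
      ∫ p, β p ∂(π : Measure (X × Y)) + ∫ x, α x ∂μ ≤ (transportCost c μ ν).toReal :=
    fun β α h => by
      have := hlim β α h
      rwa [← EReal.coe_toReal hfin hbot, EReal.coe_le_coe_iff] at this
  have hac := fst_absolutelyContinuous_of_minorant_le hA hB hL
  have hsnd : (π : Measure (X × Y)).snd = ν := by
    have h1 := ((ProbabilityMeasure.continuous_map (Ω := X × Y) continuous_snd).tendsto π).comp hsπ
    obtain ⟨i₀⟩ : Nonempty ι := l.nonempty_of_neBot
    have h2 : ∀ i, (s i).map (continuous_snd.measurable.aemeasurable (α := X × Y)) =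
        (s i₀).map continuous_snd.measurable.aemeasurable := fun i =>
      Subtype.ext ((hs i).2.trans (hs i₀).2.symm)
    have h3 := tendsto_nhds_unique h1 (tendsto_const_nhds.congr fun i => (h2 i).symm)
    exact (congrArg Subtype.val h3).trans (hs i₀).2
  refine ⟨⟨hac, hsnd⟩, le_antisymm ?_ (transportCost_le_Icmu c ⟨hac, hsnd⟩)⟩
  exact (Icmu_le_of_minorant_le hA hac hL).trans_eq (EReal.coe_toReal hfin hbot)

/-- Existence of a strong solution. -/
theorem exists_isStrongSol (hA : AssumpA c) (hB : AssumpB c) (μ : Measure X) (ν : Measure Y)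
    [IsProbabilityMeasure μ] [IsProbabilityMeasure ν] (hfin : transportCost c μ ν ≠ ⊤) :
    ∃ π : ProbabilityMeasure (X × Y), IsStrongSol c μ ν π := by
  obtain ⟨u, -, hu, hmem⟩ := exists_seq_tendsto_sInf (S := {r : EReal | ∃ q : X → FiniteMeasure Y,
    IsKernel q ∧ Transports μ q ν ∧ r = eintegralR μ fun x => c x (q x)})
    (nonempty_iff_ne_empty.2 fun h => hfin (by rw [transportCost, h, sInf_empty]))
    (OrderBot.bddBelow _)
  choose q hq hqν hqu using hmem
  choose s hs hsc using fun n => exists_memPiAC_Icmu_eq c μ ν (hq n) (hqν n)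
  have hT : Tendsto (fun n => Icmu c μ (s n)) atTop (𝓝 (transportCost c μ ν)) :=
    hu.congr fun n => (hqu n).trans (hsc n).symm
  let l : Ultrafilter ℕ := Ultrafilter.of atTop
  obtain ⟨π, -, hπ⟩ := isCompact_univ.ultrafilter_le_nhds (l.map s) (by simp)
  exact ⟨π, isStrongSol_of_tendsto hA hB hfin hs (l := (l : Filter ℕ)) hπ
    (hT.mono_left (Ultrafilter.of_le _))⟩

end StrongSolution

/-- Theorem `thm:strongsol`: under Assumptions (A) and (B), if
`I_c(μ,ν) < +∞` then every weak solution is strong; in particular there is a kernel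
minimizer `q ∈ Q(μ,ν)`. -/
theorem weakSol_isStrongSol_of_assumpB
    [CompactSpace X] [CompactSpace Y]
    (c : X → FiniteMeasure Y → ℝ) (hc : IsCost c) (hA : AssumpA c) (hB : AssumpB c)
    (μ : Measure X) (ν : Measure Y)
    [IsProbabilityMeasure μ] [IsProbabilityMeasure ν]
    (hfin : transportCost c μ ν ≠ ⊤) :
    (∀ π : ProbabilityMeasure (X × Y), IsWeakSol c μ ν π → IsStrongSol c μ ν π) ∧
    ∃ q : X → FiniteMeasure Y, IsKernel q ∧ Transports μ q ν ∧
      eintegralR μ (fun x => c x (q x)) = transportCost c μ ν := by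
  refine ⟨fun π ⟨_, hs, hsπ, hT⟩ => isStrongSol_of_tendsto hA hB hfin hs hsπ hT, ?_⟩
  obtain ⟨π, hπ, hcost⟩ := exists_isStrongSol hA hB μ ν hfin
  exact ⟨fiber μ π, isKernel_fiber μ π, hπ.2 ▸ transports_fiber hπ.1, hcost⟩

end UWOT
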